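/- Let d ≥ 1, let D, ρ_eq ∈ C¹(ℝ^d) with D > 0 and ρ_eq > 0, and let g ∈ C²(ℝ^d) with g > 0. Assume the functions x ↦ ln g(x) · ∇·(D ρ_eq ∇g)(x) and x ↦ D(x)ρ_eq(x)|∇g(x)|²/g(x) are Lebesgue integrable on ℝ^d, and that ∫_{|x|=R} D(x) ρ_eq(x) |ln g(x)| |∇g(x)| dS(x) → 0 as R → ∞. Then ∫_{ℝ^d} ln g(x) ∇·(D ρ_eq ∇g)(x) dx = −∫_{ℝ^d} D(x) g(x) ρ_eq(x) |∇ ln g(x)|² dx. In particular, setting ρ = g ρ_eq, the entropy production equals −∫_{ℝ^d} D(x) ρ(x) |∇ ln(ρ(x)/ρ_eq(x))|² dx ≤ −(inf_x D(x)) · I(ρ|ρ_eq). -/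

import Mathlib

open MeasureTheory Filter

/-- Divergence of a vector field on `ℝ^d`. -/
noncomputable def diverg {d : ℕ}
    (F : EuclideanSpace ℝ (Fin d) → EuclideanSpace ℝ (Fin d))
    (x : EuclideanSpace ℝ (Fin d)) : ℝ :=
  ∑ i, fderiv ℝ F x (EuclideanSpace.single i 1) i

section Auxiliary

open Metric Set Module
open scoped ENNReal NNReal Pointwise RealInnerProductSpace

section Sphere
variable {E : Type*} [NormedAddCommGroup E] [InnerProductSpace ℝ E]
  [FiniteDimensional ℝ E] [MeasurableSpace E] [BorelSpace E]

/-- A closed half sphere is a Lipschitz image of a ball under inverse stereographic projection. -/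
theorem hausdorffMeasure_half_sphere_lt_top {v : E} (hv : ‖v‖ = 1) :
    μH[(finrank ℝ E : ℝ) - 1] {x ∈ sphere (0 : E) 1 | ⟪v, x⟫ ≤ 0} < ∞ := by
  have hv0 : v ≠ 0 := by rintro rfl; simp at hv
  have hfr : (finrank ℝ (ℝ ∙ v)ᗮ : ℝ) = (finrank ℝ E : ℝ) - 1 := by
    have := Submodule.finrank_add_finrank_orthogonal (ℝ ∙ v)
    rw [finrank_span_singleton hv0] at this
    rw [← this]; push_cast; ring
  have hcont : ContDiff ℝ 1 (fun w : (ℝ ∙ v)ᗮ => stereoInvFunAux v (w : E)) :=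
    contDiff_stereoInvFunAux.comp (ℝ ∙ v)ᗮ.subtypeL.contDiff
  obtain ⟨K, hK⟩ := hcont.contDiffOn.exists_lipschitzOnWith one_ne_zero
    (convex_closedBall (0 : (ℝ ∙ v)ᗮ) 2) (isCompact_closedBall _ _)
  have hsub : {x ∈ sphere (0 : E) 1 | ⟪v, x⟫ ≤ 0} ⊆
      (fun w : (ℝ ∙ v)ᗮ => stereoInvFunAux v (w : E)) '' closedBall 0 2 := by
    rintro x ⟨hx, hvx⟩
    have hxv : x ≠ v := by
      rintro rfl
      rw [real_inner_self_eq_norm_sq, hv] at hvx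
      norm_num at hvx
    refine ⟨stereoToFun v x, ?_, congrArg Subtype.val (stereo_left_inv hv (x := ⟨x, hx⟩) hxv)⟩
    have hp : ‖(ℝ ∙ v)ᗮ.orthogonalProjectionOnto x‖ ≤ 1 := by
      refine (Submodule.norm_orthogonalProjectionOnto_apply_le _ _).trans ?_
      simpa using hx.le
    rw [mem_closedBall_zero_iff, stereoToFun_apply, norm_smul, innerSL_apply_apply, norm_div,
      Real.norm_two, Real.norm_of_nonneg (by linarith)]
    have : 2 / (1 - ⟪v, x⟫) ≤ 2 := div_le_self (by norm_num) (by linarith)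
    nlinarith [norm_nonneg ((ℝ ∙ v)ᗮ.orthogonalProjectionOnto x)]
  have hd : (0 : ℝ) ≤ finrank ℝ (ℝ ∙ v)ᗮ := Nat.cast_nonneg _
  rw [← hfr]
  refine (measure_mono hsub).trans_lt ((hK.hausdorffMeasure_image_le hd).trans_lt ?_)
  exact ENNReal.mul_lt_top (ENNReal.rpow_lt_top_of_nonneg hd ENNReal.coe_ne_top)
    (isCompact_closedBall _ _).measure_lt_top

theorem finrank_sub_one_nonneg {E : Type*} [NormedAddCommGroup E] [InnerProductSpace ℝ E]
    [FiniteDimensional ℝ E] [Nontrivial E] : (0 : ℝ) ≤ (finrank ℝ E : ℝ) - 1 := by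
  have : 1 ≤ finrank ℝ E := finrank_pos
  simpa using (Nat.one_le_cast (α := ℝ)).2 this

theorem hausdorffMeasure_sphere_lt_top [Nontrivial E] {r : ℝ} (hr : 0 < r) :
    μH[(finrank ℝ E : ℝ) - 1] (sphere (0 : E) r) < ∞ := by
  obtain ⟨v, hv⟩ := exists_norm_eq E zero_le_one
  have hunit : μH[(finrank ℝ E : ℝ) - 1] (sphere (0 : E) 1) < ∞ := by
    have hsub : sphere (0 : E) 1 ⊆ {x ∈ sphere (0 : E) 1 | ⟪v, x⟫ ≤ 0} ∪
        {x ∈ sphere (0 : E) 1 | ⟪-v, x⟫ ≤ 0} := by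
      intro x hx
      rcases le_total ⟪v, x⟫ 0 with h | h
      · exact .inl ⟨hx, h⟩
      · exact .inr ⟨hx, by simpa using h⟩
    exact (measure_mono hsub).trans_lt ((measure_union_le _ _).trans_lt
      (ENNReal.add_lt_top.2 ⟨hausdorffMeasure_half_sphere_lt_top hv,
        hausdorffMeasure_half_sphere_lt_top (by simpa using hv)⟩))
  have : sphere (0 : E) r = r • sphere (0 : E) 1 := by
    rw [smul_sphere' hr.ne']; simp [abs_of_pos hr]
  rw [this, Measure.hausdorffMeasure_smul₀ finrank_sub_one_nonneg hr.ne']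
  exact ENNReal.mul_lt_top ENNReal.coe_lt_top hunit

/-- The sector over a spherical cap of radius `δ` is covered by `O(1/δ)` balls of radius `2 * δ`. -/
theorem toSphere_closedBall_le [Nontrivial E] (μ : Measure E) [μ.IsAddHaarMeasure]
    (a : sphere (0 : E) 1) {δ : ℝ} (hδ : 0 < δ) (hδ1 : δ ≤ 1) :
    μ.toSphere (closedBall a δ) ≤
      (finrank ℝ E * (3 * 2 ^ finrank ℝ E) * μ (closedBall 0 1)) *
        ENNReal.ofReal δ ^ (finrank ℝ E - 1) := by
  have hdim : finrank ℝ E = finrank ℝ E - 1 + 1 := (Nat.sub_add_cancel finrank_pos).symm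
  set N := ⌈δ⁻¹⌉₊ with hN
  have hNpos : 0 < N := Nat.ceil_pos.2 (inv_pos.2 hδ)
  have hNδ : 1 ≤ N * δ := by
    have := Nat.le_ceil δ⁻¹
    rwa [inv_le_iff_one_le_mul₀ hδ] at this
  have hNδ' : (N + 1) * δ ≤ 3 := by
    have := (Nat.ceil_lt_add_one (inv_pos.2 hδ).le).le
    have h2 := mul_le_mul_of_nonneg_right this hδ.le
    rw [add_mul, inv_mul_cancel₀ hδ.ne'] at h2
    linarith
  have hsub : Ioo (0 : ℝ) 1 • ((↑) '' closedBall a δ : Set E) ⊆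
      ⋃ k ∈ Finset.range (N + 1), closedBall (((k : ℝ) / N) • (a : E)) (2 * δ) := by
    rintro _ ⟨t, ⟨ht0, ht1⟩, _, ⟨x, hx, rfl⟩, rfl⟩
    have hN0 : (0 : ℝ) < N := Nat.cast_pos.2 hNpos
    simp only [mem_iUnion, Finset.mem_range]
    have hk1 := Nat.floor_le (a := t * N) (by positivity)
    have hk2 := (Nat.lt_floor_add_one (t * N)).le
    refine ⟨⌊t * N⌋₊, ?_, ?_⟩
    · rw [Nat.lt_succ_iff]
      exact Nat.floor_le_of_le (by nlinarith)
    · have ha : ‖(a : E)‖ = 1 := norm_eq_of_mem_sphere a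
      have hxa : ‖(x : E) - a‖ ≤ δ := by
        rw [← dist_eq_norm]; exact hx
      rw [mem_closedBall, dist_eq_norm]
      have hsplit : t • (x : E) - ((⌊t * N⌋₊ : ℝ) / N) • (a : E) =
          t • ((x : E) - a) + (t - (⌊t * N⌋₊ : ℝ) / N) • (a : E) := by
        rw [smul_sub, sub_smul]; abel
      have h1 : 0 ≤ t - (⌊t * N⌋₊ : ℝ) / N := by
        rw [sub_nonneg, div_le_iff₀ hN0]; exact hk1
      have h2 : t - (⌊t * N⌋₊ : ℝ) / N ≤ δ := by
        rw [sub_le_iff_le_add, ← sub_le_iff_le_add', le_div_iff₀ hN0]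
        nlinarith
      calc _ ≤ ‖t • ((x : E) - a)‖ + ‖(t - (⌊t * N⌋₊ : ℝ) / N) • (a : E)‖ := by
            rw [hsplit]; exact norm_add_le _ _
        _ ≤ 2 * δ := by
            rw [norm_smul, norm_smul, Real.norm_of_nonneg ht0.le, Real.norm_of_nonneg h1, ha]
            nlinarith [norm_nonneg ((x : E) - a)]
  have hvol : μ (Ioo (0 : ℝ) 1 • ((↑) '' closedBall a δ : Set E)) ≤
      (3 * 2 ^ finrank ℝ E) * ENNReal.ofReal δ ^ (finrank ℝ E - 1) * μ (closedBall 0 1) := by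
    calc _ ≤ ∑ k ∈ Finset.range (N + 1), μ (closedBall (((k : ℝ) / N) • (a : E)) (2 * δ)) :=
          (measure_mono hsub).trans (measure_biUnion_finset_le _ _)
      _ = ENNReal.ofReal ((N + 1) * (2 * δ) ^ finrank ℝ E) * μ (closedBall 0 1) := by
          simp_rw [Measure.addHaar_closedBall' μ _ (by positivity : 0 ≤ 2 * δ)]
          rw [Finset.sum_const, Finset.card_range, nsmul_eq_mul, ← mul_assoc,
            ENNReal.ofReal_mul (by positivity)]
          congr 2
          rw [← Nat.cast_succ, ENNReal.ofReal_natCast]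
      _ ≤ ENNReal.ofReal (3 * 2 ^ finrank ℝ E * δ ^ (finrank ℝ E - 1)) * μ (closedBall 0 1) := by
          gcongr ENNReal.ofReal ?_ * _
          have hpow : δ ^ finrank ℝ E = δ ^ (finrank ℝ E - 1) * δ := by
            rw [← pow_succ, ← hdim]
          rw [mul_pow, hpow]
          have : 0 ≤ 2 ^ finrank ℝ E * δ ^ (finrank ℝ E - 1) := by positivity
          nlinarith
      _ = _ := by
          rw [ENNReal.ofReal_mul (by positivity), ENNReal.ofReal_mul (by positivity),
            ENNReal.ofReal_pow hδ.le, ENNReal.ofReal_pow (by norm_num)]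
          norm_num
  rw [Measure.toSphere_apply' μ isClosed_closedBall.measurableSet]
  calc _ ≤ (finrank ℝ E : ℝ≥0∞) * ((3 * 2 ^ finrank ℝ E) *
        ENNReal.ofReal δ ^ (finrank ℝ E - 1) * μ (closedBall 0 1)) := by gcongr
    _ = _ := by ring

theorem exists_toSphere_le_smul_hausdorffMeasure [Nontrivial E] (μ : Measure E)
    [μ.IsAddHaarMeasure] :
    ∃ C : ℝ≥0∞, C ≠ ∞ ∧ μ.toSphere ≤ C • μH[(finrank ℝ E : ℝ) - 1] := by
  set C : ℝ≥0∞ := finrank ℝ E * (3 * 2 ^ finrank ℝ E) * μ (closedBall 0 1) with hC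
  have hC0 : C ≠ 0 := by
    have : μ (closedBall (0 : E) 1) ≠ 0 := (measure_closedBall_pos μ _ one_pos).ne'
    simp [hC, this, (finrank_pos (R := ℝ) (M := E)).ne']
  have hCtop : C ≠ ∞ := by
    have : μ (closedBall (0 : E) 1) ≠ ∞ := measure_closedBall_lt_top.ne
    finiteness
  have hpow (t : ℝ≥0∞) : t ^ ((finrank ℝ E : ℝ) - 1) = t ^ (finrank ℝ E - 1) := by
    rw [← ENNReal.rpow_natCast, Nat.cast_sub finrank_pos, Nat.cast_one]
  have key : C⁻¹ • μ.toSphere ≤ μH[(finrank ℝ E : ℝ) - 1] := by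
    refine Measure.le_hausdorffMeasure _ _ (1 / 2) (by norm_num) fun s hs => ?_
    rcases s.eq_empty_or_nonempty with rfl | ⟨a, ha⟩
    · simp
    rw [hpow, Measure.smul_apply, smul_eq_mul, mul_comm, ← div_eq_mul_inv,
      ENNReal.div_le_iff' hC0 hCtop]
    have hfin : ediam s ≠ ∞ := ne_top_of_le_ne_top (by norm_num) hs
    have hbound : ∀ᶠ δ in nhdsWithin (ediam s) (Ioi (ediam s)),
        μ.toSphere s ≤ C * δ ^ (finrank ℝ E - 1) := by
      have : Ioo (ediam s) 1 ∈ nhdsWithin (ediam s) (Ioi (ediam s)) :=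
        Ioo_mem_nhdsGT (hs.trans_lt (by simp))
      filter_upwards [this] with δ hδ
      have hδtop : δ ≠ ∞ := (hδ.2.trans ENNReal.one_lt_top).ne
      have hδ0 : 0 < δ.toReal := ENNReal.toReal_pos (zero_le.trans_lt hδ.1).ne' hδtop
      have hsub : s ⊆ closedBall a δ.toReal := fun x hx => by
        rw [mem_closedBall, dist_edist]
        exact ENNReal.toReal_mono hδtop ((edist_le_ediam_of_mem hx ha).trans hδ.1.le)
      calc μ.toSphere s ≤ μ.toSphere (closedBall a δ.toReal) := measure_mono hsub
        _ ≤ C * ENNReal.ofReal δ.toReal ^ (finrank ℝ E - 1) :=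
          toSphere_closedBall_le μ a hδ0
            (ENNReal.toReal_le_of_le_ofReal zero_le_one (by simpa using hδ.2.le))
        _ = _ := by rw [ENNReal.ofReal_toReal hδtop]
    have hne : (nhdsWithin (ediam s) (Ioi (ediam s))).NeBot :=
      nhdsGT_neBot_of_exists_gt ⟨∞, hfin.lt_top⟩
    refine ge_of_tendsto (ENNReal.Tendsto.const_mul ?_ (.inr hCtop)) hbound
    exact ((ENNReal.continuous_pow _).tendsto _).mono_left nhdsWithin_le_nhds
  refine ⟨C, hCtop, Measure.le_iff'.2 fun s => ?_⟩
  have := Measure.le_iff'.1 key s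
  rwa [Measure.smul_apply, smul_eq_mul, mul_comm, ← div_eq_mul_inv,
      ENNReal.div_le_iff' hC0 hCtop] at this

/-- Integration in polar coordinates. -/
theorem lintegral_eq_lintegral_Ioi_lintegral_toSphere [Nontrivial E] (μ : Measure E)
    [μ.IsAddHaarMeasure] {f : E → ℝ≥0∞} (hf : Measurable f) :
    ∫⁻ x, f x ∂μ = ∫⁻ r in Ioi (0 : ℝ), ENNReal.ofReal (r ^ (finrank ℝ E - 1)) *
      ∫⁻ ω : sphere (0 : E) 1, f (r • (ω : E)) ∂μ.toSphere := by
  have hF : Measurable (fun p : sphere (0 : E) 1 × Ioi (0 : ℝ) => f ((p.2 : ℝ) • (p.1 : E))) :=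
    hf.comp (by fun_prop)
  calc ∫⁻ x, f x ∂μ = ∫⁻ x : ({(0)}ᶜ : Set E), f x ∂(μ.comap (↑)) := by
        rw [lintegral_subtype_comap (measurableSet_singleton _).compl, restrict_compl_singleton]
    _ = ∫⁻ p : sphere (0 : E) 1 × Ioi (0 : ℝ), f ((p.2 : ℝ) • (p.1 : E))
          ∂(μ.toSphere.prod (.volumeIoiPow (finrank ℝ E - 1))) := by
        rw [← μ.measurePreserving_homeomorphUnitSphereProd.lintegral_comp hF]
        refine lintegral_congr fun x => ?_
        have hx : ‖(x : E)‖ ≠ 0 := norm_ne_zero_iff.2 x.2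
        simp [smul_smul, hx]
    _ = ∫⁻ r : Ioi (0 : ℝ), ∫⁻ ω : sphere (0 : E) 1, f ((r : ℝ) • (ω : E)) ∂μ.toSphere
          ∂(.volumeIoiPow (finrank ℝ E - 1)) := lintegral_prod_symm _ hF.aemeasurable
    _ = _ := by
        rw [Measure.volumeIoiPow, lintegral_withDensity_eq_lintegral_mul _ (by fun_prop)
          hF.lintegral_prod_left']
        exact lintegral_subtype_comap measurableSet_Ioi (fun r : ℝ =>
          ENNReal.ofReal (r ^ (finrank ℝ E - 1)) *
            ∫⁻ ω : sphere (0 : E) 1, f (r • (ω : E)) ∂μ.toSphere)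

theorem lintegral_sphere_hausdorffMeasure_eq [Nontrivial E] {r : ℝ} (hr : 0 < r)
    {f : E → ℝ≥0∞} (hf : Measurable f) :
    ENNReal.ofReal (r ^ (finrank ℝ E - 1)) *
      ∫⁻ ω : sphere (0 : E) 1, f (r • (ω : E)) ∂μH[(finrank ℝ E : ℝ) - 1] =
    ∫⁻ x in sphere (0 : E) r, f x ∂μH[(finrank ℝ E : ℝ) - 1] := by
  have hmap : ENNReal.ofReal (r ^ (finrank ℝ E - 1)) •
      Measure.map (fun ω : sphere (0 : E) 1 => r • (ω : E)) μH[(finrank ℝ E : ℝ) - 1] =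
      (μH[(finrank ℝ E : ℝ) - 1]).restrict (sphere (0 : E) r) := by
    ext s hs
    have himg : s ∩ sphere (0 : E) r =
        r • ((↑) '' ((fun ω : sphere (0 : E) 1 => r • (ω : E)) ⁻¹' s) : Set E) := by
      ext x
      constructor
      · rintro ⟨hxs, hx⟩
        have hx' : ‖x‖ = r := by simpa using hx
        have hxx : r • r⁻¹ • x = x := smul_inv_smul₀ hr.ne' x
        refine ⟨r⁻¹ • x, ⟨⟨r⁻¹ • x, ?_⟩, ?_, rfl⟩, hxx⟩
        · simp [norm_smul, hx', abs_of_pos hr, hr.ne']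
        · simpa [hxx] using hxs
      · rintro ⟨_, ⟨ω, hω, rfl⟩, rfl⟩
        exact ⟨hω, by simp [norm_smul, abs_of_pos hr]⟩
    rw [Measure.restrict_apply hs, himg,
      Measure.hausdorffMeasure_smul₀ finrank_sub_one_nonneg hr.ne',
      isometry_subtype_coe.hausdorffMeasure_image (.inl finrank_sub_one_nonneg),
      Measure.smul_apply, Measure.map_apply (by fun_prop) hs, smul_eq_mul, ENNReal.smul_def,
      smul_eq_mul]
    congr 1
    have : ((finrank ℝ E : ℝ) - 1) = ((finrank ℝ E - 1 : ℕ) : ℝ) := by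
      rw [Nat.cast_sub finrank_pos, Nat.cast_one]
    rw [this, NNReal.rpow_natCast, ENNReal.ofReal_pow hr.le, ENNReal.coe_pow,
      ← Real.enorm_of_nonneg hr.le, enorm_eq_nnnorm]
  rw [← hmap, lintegral_smul_measure, lintegral_map hf (by fun_prop), smul_eq_mul]

theorem exists_lintegral_shell_le [Nontrivial E] (μ : Measure E) [μ.IsAddHaarMeasure] :
    ∃ C : ℝ≥0∞, C ≠ ∞ ∧ ∀ f : E → ℝ≥0∞, Measurable f → ∀ R : ℝ, 0 < R →
      ∫⁻ x in {x | ‖x‖ ∈ Icc R (R + 1)}, f x ∂μ ≤ C * ∫⁻ r in Icc R (R + 1),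
        ∫⁻ x in sphere (0 : E) r, f x ∂μH[(finrank ℝ E : ℝ) - 1] := by
  obtain ⟨C, hC, hle⟩ := exists_toSphere_le_smul_hausdorffMeasure μ
  refine ⟨C, hC, fun f hf R hR => ?_⟩
  have hshell : MeasurableSet {x : E | ‖x‖ ∈ Icc R (R + 1)} := measurable_norm measurableSet_Icc
  rw [← lintegral_indicator hshell,
    lintegral_eq_lintegral_Ioi_lintegral_toSphere μ (hf.indicator hshell),
    ← lintegral_const_mul' _ _ hC, ← lintegral_indicator measurableSet_Icc]
  refine (setLIntegral_mono' measurableSet_Ioi fun r (hr : 0 < r) => ?_).trans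
    (setLIntegral_le_lintegral (Ioi 0) _)
  by_cases hrR : r ∈ Icc R (R + 1)
  · have hind (ω : sphere (0 : E) 1) :
        {x : E | ‖x‖ ∈ Icc R (R + 1)}.indicator f (r • (ω : E)) = f (r • (ω : E)) :=
      indicator_of_mem (by simpa [norm_smul, abs_of_pos hr] using hrR) _
    simp_rw [hind]
    rw [indicator_of_mem hrR, ← lintegral_sphere_hausdorffMeasure_eq hr hf, mul_left_comm]
    gcongr
    exact (lintegral_mono' hle le_rfl).trans_eq (lintegral_smul_measure _ _)
  · have hind (ω : sphere (0 : E) 1) :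
        {x : E | ‖x‖ ∈ Icc R (R + 1)}.indicator f (r • (ω : E)) = 0 :=
      indicator_of_notMem (by simpa [norm_smul, abs_of_pos hr] using hrR) _
    simp_rw [hind]
    simp

theorem tendsto_integral_shell_of_tendsto_integral_sphere [Nontrivial E] (μ : Measure E)
    [μ.IsAddHaarMeasure] {f : E → ℝ} (hf : Continuous f) (hf0 : ∀ x, 0 ≤ f x)
    (hlim : Tendsto (fun R => ∫ x in sphere (0 : E) R, f x ∂μH[(finrank ℝ E : ℝ) - 1])
      atTop (nhds 0)) :
    Tendsto (fun R : ℝ => ∫ x in {x | ‖x‖ ∈ Icc R (R + 1)}, f x ∂μ) atTop (nhds 0) := by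
  obtain ⟨C, hC, hle⟩ := exists_lintegral_shell_le μ
  have hsphere {r : ℝ} (hr : 0 < r) :
      ∫⁻ x in sphere (0 : E) r, ENNReal.ofReal (f x) ∂μH[(finrank ℝ E : ℝ) - 1] =
        ENNReal.ofReal (∫ x in sphere (0 : E) r, f x ∂μH[(finrank ℝ E : ℝ) - 1]) := by
    refine (ofReal_integral_eq_lintegral_ofReal ?_ (.of_forall hf0)).symm
    obtain ⟨B, hB⟩ := (isCompact_sphere (0 : E) r).exists_bound_of_continuousOn hf.continuousOn
    exact IntegrableOn.of_bound (hausdorffMeasure_sphere_lt_top hr) hf.aestronglyMeasurable B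
      ((ae_restrict_iff' isClosed_sphere.measurableSet).2 (.of_forall hB))
  have hint (R : ℝ) : ∫ x in {x | ‖x‖ ∈ Icc R (R + 1)}, f x ∂μ =
      (∫⁻ x in {x | ‖x‖ ∈ Icc R (R + 1)}, ENNReal.ofReal (f x) ∂μ).toReal :=
    integral_eq_lintegral_of_nonneg_ae (.of_forall hf0) hf.aestronglyMeasurable
  simp_rw [hint]
  rw [← ENNReal.toReal_zero]
  refine (ENNReal.tendsto_toReal ENNReal.zero_ne_top).comp ?_
  rw [ENNReal.tendsto_nhds_zero]
  intro ε hε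
  have hlim' : Tendsto (fun R => C * ENNReal.ofReal
      (∫ x in sphere (0 : E) R, f x ∂μH[(finrank ℝ E : ℝ) - 1])) atTop (nhds 0) := by
    have := ENNReal.Tendsto.const_mul (ENNReal.tendsto_ofReal hlim) (.inr hC)
    simpa using this
  obtain ⟨R₀, hR₀⟩ := eventually_atTop.1 (ENNReal.tendsto_nhds_zero.1 hlim' ε hε)
  filter_upwards [eventually_ge_atTop R₀, eventually_gt_atTop 0] with R hR hR0
  refine (hle _ hf.measurable.ennreal_ofReal R hR0).trans ?_
  rw [← lintegral_const_mul' _ _ hC]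
  calc _ ≤ ∫⁻ _ in Icc R (R + 1), ε := by
        refine setLIntegral_mono' measurableSet_Icc fun r hr => ?_
        rw [hsphere (hR0.trans_le hr.1)]
        exact hR₀ r (hR.trans hr.1)
    _ = ε := by simp

end Sphere

theorem exists_cutoff_fderiv_bound (E : Type*) [NormedAddCommGroup E] [InnerProductSpace ℝ E]
    [FiniteDimensional ℝ E] :
    ∃ M : ℝ, 0 ≤ M ∧ ∀ R : ℝ, 0 < R → ∃ φ : E → ℝ, ContDiff ℝ 1 φ ∧ HasCompactSupport φ ∧
      (∀ x, |φ x| ≤ 1) ∧ (∀ x, ‖x‖ ≤ R → φ x = 1) ∧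
      ∀ x, ‖fderiv ℝ φ x‖ ≤ {x | ‖x‖ ∈ Icc R (R + 1)}.indicator (fun _ => M) x := by
  have hη : ContDiff ℝ 1 Real.smoothTransition := Real.smoothTransition.contDiff (n := 1)
  obtain ⟨B, hB⟩ := (isCompact_Icc (a := (0 : ℝ)) (b := 1)).exists_bound_of_continuousOn
    (hη.continuous_deriv le_rfl).continuousOn
  have hB0 : 0 ≤ B := (norm_nonneg _).trans (hB 0 (by simp))
  refine ⟨B * 2, by positivity, fun R hR => ?_⟩
  set q : E → ℝ := fun x => ((R + 1) ^ 2 - ‖x‖ ^ 2) / (2 * R + 1) with hq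
  have hden : 0 < 2 * R + 1 := by linarith
  have hq1 {x : E} (hx : ‖x‖ ≤ R) : 1 ≤ q x := by
    rw [hq, le_div_iff₀ hden]; nlinarith [norm_nonneg x]
  have hq0 {x : E} (hx : R + 1 ≤ ‖x‖) : q x ≤ 0 :=
    div_nonpos_of_nonpos_of_nonneg (by nlinarith) hden.le
  have hqd : ContDiff ℝ 1 q := (contDiff_const.sub (contDiff_norm_sq ℝ)).div_const _
  have hone {x : E} (hx : ‖x‖ ≤ R) : Real.smoothTransition (q x) = 1 :=
    Real.smoothTransition.one_of_one_le (hq1 hx)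
  have hzero {x : E} (hx : R + 1 ≤ ‖x‖) : Real.smoothTransition (q x) = 0 :=
    Real.smoothTransition.zero_of_nonpos (hq0 hx)
  refine ⟨fun x => Real.smoothTransition (q x), hη.comp hqd, ?_, fun x => ?_, fun x => hone,
    fun x => ?_⟩
  · refine HasCompactSupport.intro (isCompact_closedBall (0 : E) (R + 1)) fun x hx => hzero ?_
    rw [mem_closedBall_zero_iff, not_le] at hx
    exact hx.le
  · rw [abs_of_nonneg (Real.smoothTransition.nonneg _)]
    exact Real.smoothTransition.le_one _
  by_cases hx : ‖x‖ ∈ Icc R (R + 1)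
  · rw [indicator_of_mem (s := {x : E | ‖x‖ ∈ Icc R (R + 1)}) hx]
    have hfq : HasFDerivAt q ((2 * R + 1)⁻¹ • -((2 : ℝ) • innerSL ℝ x)) x := by
      have := ((hasStrictFDerivAt_norm_sq x).hasFDerivAt.const_sub ((R + 1) ^ 2)).const_mul
        (2 * R + 1)⁻¹
      convert! this using 1
      · ext y; simp [hq, div_eq_inv_mul]
      · rw [two_smul, two_smul]
    have hfd := ((hη.differentiable one_ne_zero (q x)).hasDerivAt.comp_hasFDerivAt x hfq).fderiv
    have hqx : q x ∈ Icc (0 : ℝ) 1 := by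
      constructor
      · exact div_nonneg (by nlinarith [hx.2, norm_nonneg x]) hden.le
      · rw [hq, div_le_one hden]; nlinarith [hx.1, norm_nonneg x]
    change ‖fderiv ℝ (Real.smoothTransition ∘ q) x‖ ≤ _
    rw [hfd, norm_smul, norm_smul, norm_neg, norm_smul, innerSL_apply_norm]
    refine mul_le_mul (hB _ hqx) ?_ (by positivity) hB0
    rw [norm_inv, Real.norm_of_nonneg hden.le, Real.norm_two, inv_mul_le_iff₀ hden]
    linarith [hx.2]
  · rw [indicator_of_notMem (s := {x : E | ‖x‖ ∈ Icc R (R + 1)}) hx]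
    refine (norm_eq_zero.2 ?_).le
    rw [mem_Icc, not_and_or, not_le, not_le] at hx
    rcases hx with hx | hx
    · have : (fun x => Real.smoothTransition (q x)) =ᶠ[nhds x] fun _ => (1 : ℝ) := by
        filter_upwards [continuous_norm.continuousAt.eventually_lt continuousAt_const hx] with y hy
        exact hone hy.le
      rw [this.fderiv_eq, fderiv_const_apply]
    · have : (fun x => Real.smoothTransition (q x)) =ᶠ[nhds x] fun _ => (0 : ℝ) := by
        filter_upwards [continuousAt_const.eventually_lt continuous_norm.continuousAt hx] with y hy
        exact hzero hy.le
      rw [this.fderiv_eq, fderiv_const_apply]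

section Divergence
variable {d : ℕ} {F : EuclideanSpace ℝ (Fin d) → EuclideanSpace ℝ (Fin d)}

theorem diverg_eq_sum_fderiv_apply {x : EuclideanSpace ℝ (Fin d)} (hF : DifferentiableAt ℝ F x) :
    diverg F x = ∑ i, fderiv ℝ (fun y => F y i) x (EuclideanSpace.single i 1) := by
  refine Finset.sum_congr rfl fun i _ => ?_
  have := ((EuclideanSpace.proj (𝕜 := ℝ) i).hasFDerivAt.comp x hF.hasFDerivAt).fderiv
  change _ = fderiv ℝ (EuclideanSpace.proj (𝕜 := ℝ) i ∘ F) x _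
  rw [this]
  rfl

theorem sum_clm_single_mul (L : EuclideanSpace ℝ (Fin d) →L[ℝ] ℝ) (v : EuclideanSpace ℝ (Fin d)) :
    ∑ i, L (EuclideanSpace.single i 1) * v i = L v := by
  conv_rhs => rw [← (EuclideanSpace.basisFun (Fin d) ℝ).sum_repr v]
  simp [mul_comm]

theorem diverg_smul {u : EuclideanSpace ℝ (Fin d) → ℝ} {x : EuclideanSpace ℝ (Fin d)}
    (hu : DifferentiableAt ℝ u x) (hF : DifferentiableAt ℝ F x) :
    diverg (fun y => u y • F y) x = u x * diverg F x + fderiv ℝ u x (F x) := by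
  rw [← sum_clm_single_mul (fderiv ℝ u x) (F x)]
  simp only [diverg]
  rw [fderiv_fun_smul hu hF, Finset.mul_sum, ← Finset.sum_add_distrib]
  simp

theorem continuous_diverg (hF : ContDiff ℝ 1 F) : Continuous (diverg F) := by
  have := hF.continuous_fderiv one_ne_zero
  unfold diverg
  fun_prop

theorem integral_mul_diverg_eq_neg {φ : EuclideanSpace ℝ (Fin d) → ℝ} (hφ : ContDiff ℝ 1 φ)
    (hc : HasCompactSupport φ) (hF : ContDiff ℝ 1 F) :
    ∫ x, φ x * diverg F x = -∫ x, fderiv ℝ φ x (F x) := by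
  have hFi (i : Fin d) : ContDiff ℝ 1 (fun y => F y i) :=
    (EuclideanSpace.proj (𝕜 := ℝ) i).contDiff.comp hF
  have hφ' (v) : Continuous (fun x => fderiv ℝ φ x v) :=
    (hφ.continuous_fderiv one_ne_zero).clm_apply continuous_const
  have hFi' (i : Fin d) (v) : Continuous (fun x => fderiv ℝ (fun y => F y i) x v) :=
    ((hFi i).continuous_fderiv one_ne_zero).clm_apply continuous_const
  have h1 (i : Fin d) : Integrable (fun x =>
      φ x * fderiv ℝ (fun y => F y i) x (EuclideanSpace.single i 1)) :=
    (hφ.continuous.mul (hFi' i _)).integrable_of_hasCompactSupport hc.mul_right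
  have h2 (i : Fin d) : Integrable (fun x =>
      fderiv ℝ φ x (EuclideanSpace.single i 1) * F x i) :=
    ((hφ' _).mul (hFi i).continuous).integrable_of_hasCompactSupport
      (hc.fderiv_apply ℝ _).mul_right
  have h3 (i : Fin d) : Integrable (fun x => φ x * F x i) :=
    (hφ.continuous.mul (hFi i).continuous).integrable_of_hasCompactSupport hc.mul_right
  simp_rw [diverg_eq_sum_fderiv_apply (hF.differentiable one_ne_zero _), Finset.mul_sum,
    ← sum_clm_single_mul (fderiv ℝ φ _) (F _)]
  rw [integral_finsetSum _ fun i _ => h1 i, integral_finsetSum _ fun i _ => h2 i,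
    ← Finset.sum_neg_distrib]
  exact Finset.sum_congr rfl fun i _ => integral_mul_fderiv_eq_neg_fderiv_mul_of_integrable
    (h2 i) (h1 i) (h3 i) (fun x _ => hφ.differentiable one_ne_zero x)
    (fun x _ => (hFi i).differentiable one_ne_zero x)

/-- The integral of the divergence of a vector field vanishes if its surface integrals over
large spheres tend to zero. -/
theorem integral_diverg_eq_zero (hd : 1 ≤ d) (hF : ContDiff ℝ 1 F) (hint : Integrable (diverg F))
    (hlim : Tendsto (fun R => ∫ x in sphere (0 : EuclideanSpace ℝ (Fin d)) R,
      ‖F x‖ ∂μH[(d : ℝ) - 1]) atTop (nhds 0)) :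
    ∫ x, diverg F x = 0 := by
  have : Nonempty (Fin d) := ⟨⟨0, hd⟩⟩
  obtain ⟨M, hM0, hM⟩ := exists_cutoff_fderiv_bound (EuclideanSpace ℝ (Fin d))
  have hM' (n : ℕ) := hM (n + 1) n.cast_add_one_pos
  choose φ hφ hc hφ1 hφR hφ' using hM'
  have hshell (R : ℝ) : MeasurableSet {x : EuclideanSpace ℝ (Fin d) | ‖x‖ ∈ Icc R (R + 1)} :=
    measurable_norm measurableSet_Icc
  have hleft : Tendsto (fun n => ∫ x, φ n x * diverg F x) atTop (nhds (∫ x, diverg F x)) := by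
    refine tendsto_integral_of_dominated_convergence (fun x => ‖diverg F x‖)
      (fun n => ((hφ n).continuous.mul (continuous_diverg hF)).aestronglyMeasurable) hint.norm
      (fun n => .of_forall fun x => ?_) (.of_forall fun x => ?_)
    · rw [norm_mul]
      exact mul_le_of_le_one_left (norm_nonneg _) (hφ1 n x)
    · refine tendsto_const_nhds.congr' ?_
      obtain ⟨N, hN⟩ := exists_nat_ge ‖x‖
      filter_upwards [eventually_ge_atTop N] with n hn
      have : (N : ℝ) ≤ n := Nat.cast_le.2 hn
      rw [hφR n x (by linarith), one_mul]
  have hshell_lim := (tendsto_integral_shell_of_tendsto_integral_sphere volume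
    hF.continuous.norm (fun x => norm_nonneg _) (by simpa using hlim)).comp
    (tendsto_atTop_add_const_right _ (1 : ℝ) tendsto_natCast_atTop_atTop)
  have hright : Tendsto (fun n => ∫ x, φ n x * diverg F x) atTop (nhds 0) := by
    refine squeeze_zero_norm (fun n => ?_) (by simpa using hshell_lim.const_mul M)
    rw [integral_mul_diverg_eq_neg (hφ n) (hc n) hF, norm_neg]
    change _ ≤ M * ∫ x in {x | ‖x‖ ∈ Icc ((n : ℝ) + 1) (n + 1 + 1)}, ‖F x‖
    rw [← integral_const_mul, ← integral_indicator (hshell _)]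
    refine norm_integral_le_of_norm_le ?_ (.of_forall fun x => ?_)
    · refine IntegrableOn.integrable_indicator ?_ (hshell _)
      refine ((continuous_const.mul hF.continuous.norm).continuousOn.integrableOn_compact
        (isCompact_closedBall 0 ((n : ℝ) + 1 + 1))).mono_set fun x hx => ?_
      simpa using hx.2
    · refine ((fderiv ℝ (φ n) x).le_of_opNorm_le (hφ' n x) (F x)).trans_eq ?_
      by_cases hx : x ∈ {x : EuclideanSpace ℝ (Fin d) | ‖x‖ ∈ Icc ((n : ℝ) + 1) (n + 1 + 1)}
      · rw [indicator_of_mem hx, indicator_of_mem hx]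
      · rw [indicator_of_notMem hx, indicator_of_notMem hx, zero_mul]
  exact tendsto_nhds_unique hleft hright

end Divergence

section Gradient
variable {E : Type*} [NormedAddCommGroup E] [InnerProductSpace ℝ E] [CompleteSpace E] {g : E → ℝ}

theorem ContDiff.gradient {n : WithTop ℕ∞} (hg : ContDiff ℝ (n + 1) g) :
    ContDiff ℝ n (gradient g) :=
  (InnerProductSpace.toDual ℝ E).symm.contDiff.comp (hg.fderiv_right le_rfl)

theorem gradient_log_comp {x : E} (hg : DifferentiableAt ℝ g x) (hx : g x ≠ 0) :
    gradient (fun y => Real.log (g y)) x = (g x)⁻¹ • gradient g x := by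
  simp only [gradient]
  rw [fderiv.log hg hx, map_smul]

end Gradient

theorem iInf_mul_integral_le {α : Type*} [MeasurableSpace α] {μ : Measure α} {w h : α → ℝ}
    (hw : ∀ x, 0 ≤ w x) (hh : ∀ x, 0 ≤ h x) (hwh : Integrable (fun x => w x * h x) μ) :
    (⨅ x, w x) * ∫ x, h x ∂μ ≤ ∫ x, w x * h x ∂μ := by
  by_cases hi : Integrable h μ
  · rw [← integral_const_mul]
    refine integral_mono (hi.const_mul _) hwh fun x => ?_
    exact mul_le_mul_of_nonneg_right (ciInf_le ⟨0, forall_mem_range.2 hw⟩ x) (hh x)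
  · rw [integral_undef hi, mul_zero]
    exact integral_nonneg fun x => mul_nonneg (hw x) (hh x)

end Auxiliary

/-- the integration-by-parts identity for the entropy production:
`∫ ln g ∇·(D ρ_eq ∇g) = −∫ D g ρ_eq |∇ ln g|²`, and the resulting bound by the
entropy dissipation functional `I(ρ|ρ_eq)` with `ρ = g ρ_eq`. -/
theorem entropy_production_integration_by_parts {d : ℕ} (hd : 1 ≤ d)
    (D ρeq g : EuclideanSpace ℝ (Fin d) → ℝ)
    (hD : ContDiff ℝ 1 D) (hρeq : ContDiff ℝ 1 ρeq) (hg : ContDiff ℝ 2 g)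
    (hDpos : ∀ x, 0 < D x) (hρeqpos : ∀ x, 0 < ρeq x) (hgpos : ∀ x, 0 < g x)
    (hint1 : Integrable (fun x =>
      Real.log (g x) * diverg (fun y => (D y * ρeq y) • gradient g y) x))
    (hint2 : Integrable (fun x => D x * ρeq x * ‖gradient g x‖ ^ 2 / g x))
    (hsurf : Tendsto (fun R => ∫ x in Metric.sphere (0 : EuclideanSpace ℝ (Fin d)) R,
        D x * ρeq x * |Real.log (g x)| * ‖gradient g x‖ ∂(μH[(d : ℝ) - 1]))
      atTop (nhds 0)) :
    (∫ x, Real.log (g x) * diverg (fun y => (D y * ρeq y) • gradient g y) x)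
      = -∫ x, D x * g x * ρeq x * ‖gradient (fun y => Real.log (g y)) x‖ ^ 2 ∧
    (-∫ x, D x * g x * ρeq x * ‖gradient (fun y => Real.log (g y)) x‖ ^ 2)
      ≤ -(⨅ x, D x) * ∫ x, (g x * ρeq x) *
          ‖gradient (fun y => Real.log (g y * ρeq y / ρeq y)) x‖ ^ 2 := by
  have hlog : ContDiff ℝ 2 (fun y => Real.log (g y)) := hg.log fun x => (hgpos x).ne'
  have hgd (x) : DifferentiableAt ℝ g x := hg.differentiable two_ne_zero x
  have hV : ContDiff ℝ 1 (fun y => (D y * ρeq y) • gradient g y) :=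
    (hD.mul hρeq).smul (ContDiff.gradient (by simpa [one_add_one_eq_two] using hg))
  have hdissip (x) : D x * g x * ρeq x * ‖gradient (fun y => Real.log (g y)) x‖ ^ 2 =
      D x * ρeq x * ‖gradient g x‖ ^ 2 / g x := by
    have := (hgpos x).ne'
    rw [gradient_log_comp (hgd x) this, norm_smul, norm_inv, Real.norm_of_nonneg (hgpos x).le]
    field_simp
  have hdiv (x) : diverg (fun y => Real.log (g y) • (D y * ρeq y) • gradient g y) x =
      Real.log (g x) * diverg (fun y => (D y * ρeq y) • gradient g y) x +
        D x * ρeq x * ‖gradient g x‖ ^ 2 / g x := by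
    rw [diverg_smul (hlog.differentiable two_ne_zero x) (hV.differentiable one_ne_zero x),
      ← inner_gradient_left,
      gradient_log_comp (hgd x) (hgpos x).ne', real_inner_smul_left, real_inner_smul_right,
      real_inner_self_eq_norm_sq]
    ring
  have hzero := integral_diverg_eq_zero
    (F := fun y => Real.log (g y) • (D y * ρeq y) • gradient g y) hd
    ((hlog.of_le one_le_two).smul hV)
    ((hint1.add hint2).congr (.of_forall fun x => (hdiv x).symm)) (by
      refine hsurf.congr fun R => integral_congr_ae (.of_forall fun x => ?_)
      simp only [norm_smul, norm_mul, Real.norm_eq_abs, abs_of_pos (hDpos x),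
        abs_of_pos (hρeqpos x)]
      ring)
  simp_rw [hdiv] at hzero
  rw [integral_add hint1 hint2] at hzero
  refine ⟨?_, ?_⟩
  · simp_rw [hdissip]
    linarith
  · simp_rw [mul_div_cancel_right₀ _ (hρeqpos _).ne', mul_assoc]
    rw [neg_mul]
    refine neg_le_neg (iInf_mul_integral_le (fun x => (hDpos x).le) (fun x => ?_) ?_)
    · have := hgpos x
      have := hρeqpos x
      positivity
    · refine hint2.congr (.of_forall fun x => ?_)
      simp only [← hdissip x]
      ring
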